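/- Rademacher complexity of norm-bounded positive-homogeneous neural networks: Let H be the class of real-valued depth-L networks x ↦ W_L φ_{L−1}(W_{L−1} ⋯ φ₁(W₁ x)) with each parameter matrix Wⱼ having Frobenius norm at most B_{Wⱼ}, and each φⱼ 1-Lipschitz, positive-homogeneous, applied element-wise. If the distribution p has support bounded in norm by B_p, then the two-sided Rademacher complexity satisfies R_{n,p}(H) ≤ B_p(√(2 log(2) L) + 1)·(∏ⱼ B_{Wⱼ})/√n. -/

import Mathlib

open MeasureTheory

/-- The Rademacher distribution on ℝ: uniform on `{-1, 1}`. -/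
noncomputable def radMeasure : Measure ℝ :=
  ((1 : ENNReal) / 2) • Measure.dirac (1 : ℝ) + ((1 : ENNReal) / 2) • Measure.dirac (-1 : ℝ)

/-- Frobenius norm of a real matrix. -/
noncomputable def frobNorm {m n : ℕ} (M : Matrix (Fin m) (Fin n) ℝ) : ℝ :=
  Real.sqrt (∑ i, ∑ j, M i j ^ 2)

/-- Output of the first `j` layers of a network with weights `W` and element-wise
activations `φ` (an activation is applied after each of these layers). -/
def layerOut (dims : ℕ → ℕ) (W : ∀ j : ℕ, Matrix (Fin (dims (j + 1))) (Fin (dims j)) ℝ)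
    (φ : ℕ → ℝ → ℝ) : (j : ℕ) → (Fin (dims 0) → ℝ) → Fin (dims j) → ℝ
  | 0, x => x
  | (j + 1), x => fun i => φ j ((W j).mulVec (layerOut dims W φ j x) i)

theorem nn_frob_sq {m n : ℕ} (M : Matrix (Fin m) (Fin n) ℝ) :
    frobNorm M ^ 2 = ∑ i, ∑ j, M i j ^ 2 :=
  Real.sq_sqrt (Finset.sum_nonneg fun i _ => Finset.sum_nonneg fun j _ => sq_nonneg (M i j))

theorem nn_le_of_sq {a b : ℝ} (h : a ^ 2 ≤ b ^ 2) (hb : 0 ≤ b) : a ≤ b :=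
  (le_abs_self a).trans (abs_le_of_sq_le_sq h hb)

theorem nn_exp_core {A B A' B' : ℝ} (h1 : B ≤ A) (h2 : A - B ≤ A' - B') (h3 : B ≤ B') :
    Real.exp A + Real.exp B' ≤ Real.exp A' + Real.exp B := by
  have e1 : Real.exp A = Real.exp B * Real.exp (A - B) := by rw [← Real.exp_add]; ring_nf
  have e2 : Real.exp A' = Real.exp B' * Real.exp (A' - B') := by rw [← Real.exp_add]; ring_nf
  have h4 : Real.exp (A - B) ≤ Real.exp (A' - B') := Real.exp_le_exp.2 h2
  have h5 : 1 ≤ Real.exp (A - B) := Real.one_le_exp (by linarith)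
  have h6 : Real.exp B ≤ Real.exp B' := Real.exp_le_exp.2 h3
  have := Real.exp_pos B
  rw [e1, e2]
  nlinarith [mul_le_mul_of_nonneg_left h4 (Real.exp_pos B').le,
    mul_nonneg (sub_nonneg.2 h6) (sub_nonneg.2 h5)]

theorem nn_two_point (φ : ℝ → ℝ) (hl : ∀ x y, |φ x - φ y| ≤ |x - y|) (h0 : φ 0 = 0)
    (u w a b Mp Mm : ℝ) (h1 : Real.exp (u + a) ≤ Mp) (h2 : Real.exp (w + b) ≤ Mp)
    (h3 : Real.exp (u - a) ≤ Mm) (h4 : Real.exp (w - b) ≤ Mm) :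
    Real.exp (u + φ a) + Real.exp (w - φ b) ≤ Mp + Mm := by
  have same : ∀ u a : ℝ, Real.exp (u + φ a) + Real.exp (u - φ a) ≤
      Real.exp (u + a) + Real.exp (u - a) := by
    intro u a
    have : |φ a| ≤ |a| := by simpa [h0] using hl a 0
    have h := mul_le_mul_of_nonneg_left (Real.cosh_le_cosh.2 this) (Real.exp_pos u).le
    simp only [Real.cosh_eq] at h
    simp only [sub_eq_add_neg, Real.exp_add]
    linarith
  have ha : |φ a| ≤ |a| := by simpa [h0] using hl a 0
  have hb : |φ b| ≤ |b| := by simpa [h0] using hl b 0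
  have hab := hl a b
  by_cases c1 : u + φ a < w + φ b
  · have := Real.exp_le_exp.2 c1.le
    linarith [same w b]
  by_cases c2 : w - φ b < u - φ a
  · have := Real.exp_le_exp.2 c2.le
    linarith [same u a]
  push Not at c1 c2
  have ha' := abs_le.1 ha
  have hb' := abs_le.1 hb
  have hab' := abs_le.1 hab
  rcases le_total 0 a with sa | sa <;> rcases le_total 0 b with sb | sb
  · rw [abs_of_nonneg sa] at ha'
    rw [abs_of_nonneg sb] at hb'
    rcases le_total b a with c | c
    · rw [abs_of_nonneg (sub_nonneg.2 c)] at hab'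
      have := nn_exp_core (A := w - φ b) (B := w - b) (A' := u + a) (B' := u + φ a)
        (by linarith) (by linarith) (by linarith)
      linarith
    · rw [abs_of_nonpos (sub_nonpos.2 c)] at hab'
      have := nn_exp_core (A := u + φ a) (B := u - a) (A' := w + b) (B' := w - φ b)
        (by linarith) (by linarith) (by linarith)
      linarith
  · rw [abs_of_nonneg sa] at ha'
    rw [abs_of_nonpos sb] at hb'
    have e1 := Real.exp_le_exp.2 (show u + φ a ≤ u + a by linarith)
    have e2 := Real.exp_le_exp.2 (show w - φ b ≤ w - b by linarith)
    linarith
  · rw [abs_of_nonpos sa] at ha'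
    rw [abs_of_nonneg sb] at hb'
    have e1 := Real.exp_le_exp.2 (show u + φ a ≤ u - a by linarith)
    have e2 := Real.exp_le_exp.2 (show w - φ b ≤ w + b by linarith)
    linarith
  · rw [abs_of_nonpos sa] at ha'
    rw [abs_of_nonpos sb] at hb'
    rcases le_total b a with c | c
    · rw [abs_of_nonneg (sub_nonneg.2 c)] at hab'
      have := nn_exp_core (A := u + φ a) (B := u + a) (A' := w - b) (B' := w - φ b)
        (by linarith) (by linarith) (by linarith)
      linarith
    · rw [abs_of_nonpos (sub_nonpos.2 c)] at hab'
      have := nn_exp_core (A := w - φ b) (B := w + b) (A' := u - a) (B' := u + φ a)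
        (by linarith) (by linarith) (by linarith)
      linarith

/-- real value of a sign -/
def nnS (s : ℤˣ) : ℝ := ((s : ℤ) : ℝ)

theorem nnS_neg (s : ℤˣ) : nnS (-s) = - nnS s := by simp [nnS]

theorem nnS_cases (s : ℤˣ) : nnS s = 1 ∨ nnS s = -1 := by
  rcases Int.units_eq_one_or s with h | h <;> simp [nnS, h]

/-- flip the `i`-th sign -/
def nnFlip {n : ℕ} (i : Fin n) (σ : Fin n → ℤˣ) : Fin n → ℤˣ := Function.update σ i (-σ i)

theorem nnFlip_invol {n : ℕ} (i : Fin n) : Function.Involutive (nnFlip i) := by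
  intro σ
  simp [nnFlip]

theorem nnFlip_sum {n : ℕ} (i : Fin n) (g : (Fin n → ℤˣ) → ℝ) :
    ∑ σ, g (nnFlip i σ) = ∑ σ, g σ :=
  Equiv.sum_comp (nnFlip_invol i).toPerm g

theorem nnFlip_pair {n : ℕ} (i : Fin n) (g g' : (Fin n → ℤˣ) → ℝ)
    (h : ∀ σ, g σ + g (nnFlip i σ) ≤ g' σ + g' (nnFlip i σ)) : ∑ σ, g σ ≤ ∑ σ, g' σ := by
  have := Finset.sum_le_sum (s := Finset.univ) (fun σ _ => h σ)
  simp only [Finset.sum_add_distrib, nnFlip_sum] at this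
  linarith

theorem nn_contr_step {n : ℕ} (i : Fin n) (ψ ψ' : Fin n → ℝ → ℝ)
    (hl : ∀ x y, |ψ i x - ψ i y| ≤ |x - y|) (h0 : ψ i 0 = 0)
    (hi : ∀ x, ψ' i x = x) (hne : ∀ j, j ≠ i → ψ' j = ψ j)
    (t : (Fin n → ℤˣ) → Fin n → ℝ) :
    ∃ r : (Fin n → ℤˣ) → (Fin n → ℤˣ),
      ∑ σ, Real.exp (∑ j, nnS (σ j) * ψ j (t σ j)) ≤
      ∑ σ, Real.exp (∑ j, nnS (σ j) * ψ' j (t (r σ) j)) := by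
  have hmax : ∀ σ : Fin n → ℤˣ, ∃ ρ, ∀ τ, Real.exp (∑ j, nnS (σ j) * ψ' j (t τ j)) ≤
      Real.exp (∑ j, nnS (σ j) * ψ' j (t ρ j)) := fun σ => Finite.exists_max _
  choose r hr using hmax
  refine ⟨r, nnFlip_pair i _ _ fun σ => ?_⟩
  have split : ∀ (σ : Fin n → ℤˣ) (χ : Fin n → ℝ → ℝ) (v : Fin n → ℝ),
      ∑ j, nnS (σ j) * χ j (v j) =
      (∑ j ∈ Finset.univ.erase i, nnS (σ j) * χ j (v j)) + nnS (σ i) * χ i (v i) := by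
    intro σ χ v
    rw [Finset.sum_erase_add _ _ (Finset.mem_univ i)]
  have e1 : ∀ (σ : Fin n → ℤˣ) (v : Fin n → ℝ), (∑ j ∈ Finset.univ.erase i, nnS (σ j) * ψ' j (v j)) =
      ∑ j ∈ Finset.univ.erase i, nnS (σ j) * ψ j (v j) := by
    intro σ v
    refine Finset.sum_congr rfl fun j hj => ?_
    rw [hne j (Finset.ne_of_mem_erase hj)]
  have e2 : ∀ v : Fin n → ℝ, (∑ j ∈ Finset.univ.erase i, nnS (nnFlip i σ j) * ψ j (v j)) =
      ∑ j ∈ Finset.univ.erase i, nnS (σ j) * ψ j (v j) := by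
    intro v
    refine Finset.sum_congr rfl fun j hj => ?_
    simp [nnFlip, Finset.ne_of_mem_erase hj]
  have e3 : nnS (nnFlip i σ i) = - nnS (σ i) := by simp [nnFlip, nnS_neg]
  have k1 := hr σ σ
  have k2 := hr σ (nnFlip i σ)
  have k3 := hr (nnFlip i σ) σ
  have k4 := hr (nnFlip i σ) (nnFlip i σ)
  generalize Real.exp (∑ j, nnS (σ j) * ψ' j (t (r σ) j)) = M1 at *
  generalize Real.exp (∑ j, nnS (nnFlip i σ j) * ψ' j (t (r (nnFlip i σ)) j)) = M2 at *
  rw [split, e1, hi] at k1 k2 k3 k4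
  rw [e2, e3] at k3 k4
  rw [split σ ψ, split (nnFlip i σ) ψ, e2, e3]
  generalize (∑ j ∈ Finset.univ.erase i, nnS (σ j) * ψ j (t σ j)) = u at *
  generalize (∑ j ∈ Finset.univ.erase i, nnS (σ j) * ψ j (t (nnFlip i σ) j)) = w at *
  rcases nnS_cases (σ i) with h | h <;> rw [h] at k1 k2 k3 k4 ⊢
  · have := nn_two_point (ψ i) hl h0 u w (t σ i) (t (nnFlip i σ) i) M1 M2
      (by convert k1 using 2; ring) (by convert k2 using 2; ring)
      (by convert k3 using 2; ring) (by convert k4 using 2; ring)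
    convert this using 3 <;> ring
  · have := nn_two_point (ψ i) hl h0 w u (t (nnFlip i σ) i) (t σ i) M2 M1
      (by convert k4 using 2; ring) (by convert k3 using 2; ring)
      (by convert k2 using 2; ring) (by convert k1 using 2; ring)
    rw [add_comm M1, add_comm]
    convert this using 3 <;> ring

theorem nn_contr {n : ℕ} (φ : ℝ → ℝ) (hl : ∀ x y, |φ x - φ y| ≤ |x - y|) (h0 : φ 0 = 0)
    (t : (Fin n → ℤˣ) → Fin n → ℝ) :
    ∃ r : (Fin n → ℤˣ) → (Fin n → ℤˣ),
      ∑ σ, Real.exp (∑ j, nnS (σ j) * φ (t σ j)) ≤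
      ∑ σ, Real.exp (∑ j, nnS (σ j) * t (r σ) j) := by
  classical
  have key : ∀ A : Finset (Fin n), ∃ r : (Fin n → ℤˣ) → (Fin n → ℤˣ),
      ∑ σ, Real.exp (∑ j, nnS (σ j) * φ (t σ j)) ≤
      ∑ σ, Real.exp (∑ j, nnS (σ j) * (if j ∈ A then id else φ) (t (r σ) j)) := by
    intro A
    induction A using Finset.induction_on with
    | empty => exact ⟨id, by simp⟩
    | insert i A hi ih =>
      obtain ⟨r, hr⟩ := ih
      obtain ⟨r', hr'⟩ := nn_contr_step i (fun j => if j ∈ A then id else φ)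
        (fun j => if j ∈ insert i A then id else φ) (by simpa [hi] using hl) (by simpa [hi] using h0)
        (by simp) (by intro j hj; simp [hj]) (fun σ => t (r σ))
      exact ⟨r ∘ r', hr.trans hr'⟩
  obtain ⟨r, hr⟩ := key Finset.univ
  exact ⟨r, by simpa using hr⟩

/-- Euclidean norm -/
noncomputable def nnN {d : ℕ} (v : Fin d → ℝ) : ℝ := Real.sqrt (∑ i, v i ^ 2)

theorem nnN_nonneg {d : ℕ} (v : Fin d → ℝ) : 0 ≤ nnN v := Real.sqrt_nonneg _

theorem nnN_sq {d : ℕ} (v : Fin d → ℝ) : nnN v ^ 2 = ∑ i, v i ^ 2 :=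
  Real.sq_sqrt (Finset.sum_nonneg fun _ _ => sq_nonneg _)

theorem nn_cs {d : ℕ} (v w : Fin d → ℝ) : |∑ i, v i * w i| ≤ nnN v * nnN w := by
  apply abs_le_of_sq_le_sq _ (mul_nonneg (nnN_nonneg _) (nnN_nonneg _))
  rw [mul_pow, nnN_sq, nnN_sq]
  exact Finset.sum_mul_sq_le_sq_mul_sq _ _ _

theorem nn_cosh_pair (u v A B : ℝ) (h1 : u ^ 2 + v ^ 2 = 2 * (A ^ 2 + B ^ 2))
    (h2 : |u ^ 2 - v ^ 2| ≤ 4 * (A * B)) :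
    Real.cosh u + Real.cosh v ≤ 2 * (Real.cosh A * Real.cosh B) := by
  have e : 2 * (Real.cosh A * Real.cosh B) = Real.cosh (A + B) + Real.cosh (A - B) := by
    rw [Real.cosh_add, Real.cosh_sub]; ring
  rw [e]
  refine hasSum_le (fun k => ?_) ((Real.hasSum_cosh u).add (Real.hasSum_cosh v))
    ((Real.hasSum_cosh (A + B)).add (Real.hasSum_cosh (A - B)))
  rw [← add_div, ← add_div]
  refine div_le_div_of_nonneg_right ?_ (by positivity)
  rw [pow_mul, pow_mul, pow_mul, pow_mul]
  have hh := abs_le.1 h2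
  have x1 : u ^ 2 = (A ^ 2 + B ^ 2) + (u ^ 2 - v ^ 2) / 2 := by linarith
  have x2 : v ^ 2 = (A ^ 2 + B ^ 2) - (u ^ 2 - v ^ 2) / 2 := by linarith
  by_cases hz : A * B ≤ 0
  · have : A * B = 0 := by linarith [abs_nonneg (u ^ 2 - v ^ 2)]
    have y1 : u ^ 2 = A ^ 2 + B ^ 2 := by linarith
    have y2 : v ^ 2 = A ^ 2 + B ^ 2 := by linarith
    have y3 : (A + B) ^ 2 = A ^ 2 + B ^ 2 := by nlinarith
    have y4 : (A - B) ^ 2 = A ^ 2 + B ^ 2 := by nlinarith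
    rw [y1, y2, y3, y4]
  · push Not at hz
    set s := 1 / 2 + (u ^ 2 - v ^ 2) / (8 * (A * B)) with hs
    have hq : |(u ^ 2 - v ^ 2) / (8 * (A * B))| ≤ 1 / 2 := by
      rw [abs_div, abs_of_pos (show 0 < 8 * (A * B) by linarith), div_le_iff₀ (by linarith)]
      linarith
    have hq' := abs_le.1 hq
    have hs0 : 0 ≤ s := by linarith
    have hs1 : 0 ≤ 1 - s := by linarith
    have hsm : (s - 1 / 2) * (8 * (A * B)) = u ^ 2 - v ^ 2 := by
      rw [hs, add_sub_cancel_left, div_mul_cancel₀]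
      linarith
    have cv := convexOn_pow (𝕜 := ℝ) k
    have c1 := cv.2 (Set.mem_Ici.2 (sq_nonneg (A + B))) (Set.mem_Ici.2 (sq_nonneg (A - B)))
      hs0 hs1 (by ring)
    have c2 := cv.2 (Set.mem_Ici.2 (sq_nonneg (A + B))) (Set.mem_Ici.2 (sq_nonneg (A - B)))
      hs1 hs0 (by ring)
    simp only [smul_eq_mul] at c1 c2
    have y1 : u ^ 2 = s * (A + B) ^ 2 + (1 - s) * (A - B) ^ 2 := by rw [x1, ← hsm]; ring
    have y2 : v ^ 2 = (1 - s) * (A + B) ^ 2 + s * (A - B) ^ 2 := by rw [x2, ← hsm]; ring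
    rw [y1, y2]
    linarith

theorem nn_cosh_sum {n d : ℕ} (x : Fin n → Fin d → ℝ) (c : ℝ) (A : Finset (Fin n)) :
    ∑ σ : Fin n → ℤˣ, Real.cosh (c * nnN (fun a => ∑ i ∈ A, nnS (σ i) * x i a)) ≤
      (Fintype.card (Fin n → ℤˣ) : ℝ) * ∏ i ∈ A, Real.cosh (c * nnN (x i)) := by
  classical
  induction A using Finset.induction_on with
  | empty => simp [nnN]
  | insert i A hi ih =>
    rw [Finset.prod_insert hi]
    have step : ∑ σ : Fin n → ℤˣ, Real.cosh (c * nnN (fun a => ∑ j ∈ insert i A, nnS (σ j) * x j a))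
        ≤ ∑ σ : Fin n → ℤˣ, Real.cosh (c * nnN (fun a => ∑ j ∈ A, nnS (σ j) * x j a))
          * Real.cosh (c * nnN (x i)) := by
      apply nnFlip_pair i
      intro σ
      have e2 : ∀ a, (∑ j ∈ A, nnS (nnFlip i σ j) * x j a) = ∑ j ∈ A, nnS (σ j) * x j a := by
        intro a
        refine Finset.sum_congr rfl fun j hj => ?_
        have : j ≠ i := by rintro rfl; exact hi hj
        simp [nnFlip, this]
      have e3 : nnS (nnFlip i σ i) = - nnS (σ i) := by simp [nnFlip, nnS_neg]
      simp only [Finset.sum_insert hi, e2, e3]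
      generalize hS : (fun a => ∑ j ∈ A, nnS (σ j) * x j a) = S
      have hS' : ∀ a, ∑ j ∈ A, nnS (σ j) * x j a = S a := fun a => congrFun hS a
      simp only [hS']
      have hss : nnS (σ i) ^ 2 = 1 := by rcases nnS_cases (σ i) with h | h <;> rw [h] <;> norm_num
      have hsa : |nnS (σ i)| = 1 := by rcases nnS_cases (σ i) with h | h <;> rw [h] <;> norm_num
      have q1 : nnN (fun a => nnS (σ i) * x i a + S a) ^ 2 =
          nnN (x i) ^ 2 + nnN S ^ 2 + 2 * nnS (σ i) * ∑ a, x i a * S a := by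
        simp only [nnN_sq, Finset.mul_sum, ← Finset.sum_add_distrib]
        refine Finset.sum_congr rfl fun a _ => ?_
        linear_combination (x i a) ^ 2 * hss
      have q2 : nnN (fun a => -nnS (σ i) * x i a + S a) ^ 2 =
          nnN (x i) ^ 2 + nnN S ^ 2 - 2 * nnS (σ i) * ∑ a, x i a * S a := by
        simp only [nnN_sq, Finset.mul_sum, ← Finset.sum_add_distrib, ← Finset.sum_sub_distrib]
        refine Finset.sum_congr rfl fun a _ => ?_
        linear_combination (x i a) ^ 2 * hss
      have := nn_cosh_pair (c * nnN (fun a => nnS (σ i) * x i a + S a))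
        (c * nnN (fun a => -nnS (σ i) * x i a + S a)) (c * nnN S) (c * nnN (x i))
        (by simp only [mul_pow, q1, q2]; ring)
        (by
          simp only [mul_pow, q1, q2]
          have : c ^ 2 * (nnN (x i) ^ 2 + nnN S ^ 2 + 2 * nnS (σ i) * ∑ a, x i a * S a) -
            c ^ 2 * (nnN (x i) ^ 2 + nnN S ^ 2 - 2 * nnS (σ i) * ∑ a, x i a * S a) =
            4 * c ^ 2 * (nnS (σ i) * ∑ a, x i a * S a) := by ring
          rw [this, abs_mul, abs_mul (nnS (σ i)), hsa, abs_of_nonneg (show 0 ≤ 4 * c ^ 2 by positivity)]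
          nlinarith [mul_le_mul_of_nonneg_left (nn_cs (x i) S) (show 0 ≤ 4 * c ^ 2 by positivity)])
      linarith
    rw [← Finset.sum_mul] at step
    refine step.trans ?_
    have := mul_le_mul_of_nonneg_right ih (Real.cosh_pos (c * nnN (x i))).le
    linarith

theorem nn_exp_sum {n d : ℕ} (x : Fin n → Fin d → ℝ) (c b : ℝ) (hx : ∀ i, nnN (x i) ≤ b) :
    ∑ σ : Fin n → ℤˣ, Real.exp (c * nnN (fun a => ∑ i, nnS (σ i) * x i a)) ≤
      2 * (Fintype.card (Fin n → ℤˣ) : ℝ) * Real.exp (c ^ 2 * (n * b ^ 2) / 2) := by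
  have h1 : ∑ σ : Fin n → ℤˣ, Real.exp (c * nnN (fun a => ∑ i, nnS (σ i) * x i a)) ≤
      2 * ∑ σ : Fin n → ℤˣ, Real.cosh (c * nnN (fun a => ∑ i, nnS (σ i) * x i a)) := by
    rw [Finset.mul_sum]
    refine Finset.sum_le_sum fun σ _ => ?_
    rw [Real.cosh_eq]
    linarith [Real.exp_pos (-(c * nnN (fun a => ∑ i, nnS (σ i) * x i a)))]
  have h2 := nn_cosh_sum x c Finset.univ
  have h3 : ∏ i, Real.cosh (c * nnN (x i)) ≤ Real.exp (c ^ 2 * (n * b ^ 2) / 2) := by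
    have : ∏ i, Real.cosh (c * nnN (x i)) ≤ ∏ i : Fin n, Real.exp (c ^ 2 * b ^ 2 / 2) := by
      refine Finset.prod_le_prod (fun i _ => (Real.cosh_pos _).le) fun i _ => ?_
      refine (Real.cosh_le_exp_half_sq _).trans (Real.exp_le_exp.2 ?_)
      have : nnN (x i) ^ 2 ≤ b ^ 2 := pow_le_pow_left₀ (nnN_nonneg _) (hx i) 2
      rw [mul_pow]
      nlinarith [mul_le_mul_of_nonneg_left this (sq_nonneg c)]
    refine this.trans (le_of_eq ?_)
    rw [Finset.prod_const, ← Real.exp_nat_mul]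
    simp
    ring
  have h4 := mul_le_mul_of_nonneg_left h3
    (show (0:ℝ) ≤ (Fintype.card (Fin n → ℤˣ) : ℝ) by positivity)
  linarith

theorem nn_row {n d d' : ℕ} (φ : ℝ → ℝ) (h0 : φ 0 = 0)
    (hh : ∀ c t : ℝ, 0 ≤ c → φ (c * t) = c * φ t)
    (M : Matrix (Fin d') (Fin d) ℝ) (R : ℝ) (hM : frobNorm M ≤ R)
    (s : Fin n → ℝ) (f : Fin n → Fin d → ℝ) :
    ∃ w : Fin d → ℝ, nnN w ≤ 1 ∧
      nnN (fun a => ∑ i, s i * φ (M.mulVec (f i) a)) ≤ R * |∑ i, s i * φ (∑ b, w b * f i b)| := by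
  have hR : 0 ≤ R := (Real.sqrt_nonneg _).trans hM
  rcases Nat.eq_zero_or_pos d' with rfl | hd
  · refine ⟨0, by simp [nnN], ?_⟩
    simp [nnN, h0]
  have : Nonempty (Fin d') := ⟨⟨0, hd⟩⟩
  have hrow : ∀ a, ∃ w : Fin d → ℝ, nnN w ≤ 1 ∧ ∀ b, M a b = nnN (M a) * w b := by
    intro a
    by_cases hz : nnN (M a) = 0
    · refine ⟨0, by simp [nnN], fun b => ?_⟩
      have h1 := nnN_sq (M a)
      rw [hz] at h1
      have h2 := (Finset.sum_eq_zero_iff_of_nonneg (fun b _ => sq_nonneg (M a b))).1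
        (by rw [← h1]; norm_num) b (Finset.mem_univ b)
      simpa using h2
    · refine ⟨fun b => M a b / nnN (M a), ?_, fun b => by field_simp⟩
      have : nnN (fun b => M a b / nnN (M a)) ^ 2 = 1 := by
        rw [nnN_sq]
        simp only [div_pow]
        rw [← Finset.sum_div, ← nnN_sq, div_self (pow_ne_zero 2 hz)]
      nlinarith [nnN_nonneg (fun b => M a b / nnN (M a))]
  choose w hw1 hw2 using hrow
  obtain ⟨a0, ha0⟩ := Finite.exists_max (fun a => |∑ i, s i * φ (∑ b, w a b * f i b)|)
  refine ⟨w a0, hw1 a0, ?_⟩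
  set U := |∑ i, s i * φ (∑ b, w a0 b * f i b)| with hU
  have hU0 : 0 ≤ U := abs_nonneg _
  have hV : ∀ a, ∑ i, s i * φ (M.mulVec (f i) a) =
      nnN (M a) * ∑ i, s i * φ (∑ b, w a b * f i b) := by
    intro a
    rw [Finset.mul_sum]
    refine Finset.sum_congr rfl fun i _ => ?_
    have : M.mulVec (f i) a = nnN (M a) * ∑ b, w a b * f i b := by
      rw [Matrix.mulVec, dotProduct, Finset.mul_sum]
      refine Finset.sum_congr rfl fun b _ => ?_
      rw [hw2 a b]; ring
    rw [this, hh _ _ (nnN_nonneg _)]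
    ring
  refine nn_le_of_sq ?_ (mul_nonneg hR hU0)
  rw [nnN_sq]
  have hF : ∑ a, nnN (M a) ^ 2 ≤ R ^ 2 := by
    have : ∑ a, nnN (M a) ^ 2 = frobNorm M ^ 2 := by
      rw [nn_frob_sq]
      exact Finset.sum_congr rfl fun a _ => nnN_sq (M a)
    rw [this]
    exact pow_le_pow_left₀ (Real.sqrt_nonneg _) hM 2
  calc ∑ a, (∑ i, s i * φ (M.mulVec (f i) a)) ^ 2 ≤ ∑ a, nnN (M a) ^ 2 * U ^ 2 := by
        refine Finset.sum_le_sum fun a _ => ?_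
        rw [hV, mul_pow]
        refine mul_le_mul_of_nonneg_left ?_ (sq_nonneg _)
        rw [← sq_abs (∑ i, s i * φ (∑ b, w a b * f i b))]
        exact pow_le_pow_left₀ (abs_nonneg _) (ha0 a) 2
    _ ≤ (R * U) ^ 2 := by
        rw [← Finset.sum_mul, mul_pow]
        exact mul_le_mul_of_nonneg_right hF (sq_nonneg _)

theorem nn_peel {n d d' : ℕ} (φ : ℝ → ℝ) (hl : ∀ x y, |φ x - φ y| ≤ |x - y|) (h0 : φ 0 = 0)
    (hh : ∀ c t : ℝ, 0 ≤ c → φ (c * t) = c * φ t)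
    (M : (Fin n → ℤˣ) → Matrix (Fin d') (Fin d) ℝ) (R : ℝ) (hR : 0 ≤ R)
    (hM : ∀ σ, frobNorm (M σ) ≤ R)
    (f : (Fin n → ℤˣ) → Fin n → Fin d → ℝ) (c C : ℝ) (hc : 0 ≤ c)
    (hC : ∀ r : (Fin n → ℤˣ) → (Fin n → ℤˣ),
      ∑ σ, Real.exp ((c * R) * nnN (fun a => ∑ i, nnS (σ i) * f (r σ) i a)) ≤ C) :
    ∑ σ, Real.exp (c * nnN (fun a => ∑ i, nnS (σ i) * φ ((M σ).mulVec (f σ i) a))) ≤ 2 * C := by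
  have hw := fun σ => nn_row φ h0 hh (M σ) R (hM σ) (fun i => nnS (σ i)) (f σ)
  choose w hw1 hw2 using hw
  have hcR := mul_nonneg hc hR
  have main : ∀ q : (Fin n → ℤˣ) → (Fin n → ℤˣ),
      ∑ σ, Real.exp (c * R * ∑ i, nnS (σ i) * φ (∑ b, w (q σ) b * f (q σ) i b)) ≤ C := by
    intro q
    obtain ⟨r, hr⟩ := nn_contr φ hl h0 (fun σ i => c * R * ∑ b, w (q σ) b * f (q σ) i b)
    refine le_trans (le_of_eq ?_) (hr.trans (le_trans ?_ (hC (q ∘ r))))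
    · refine Finset.sum_congr rfl fun σ _ => ?_
      rw [Finset.mul_sum]
      congr 1
      refine Finset.sum_congr rfl fun i _ => ?_
      rw [hh _ _ hcR]; ring
    · refine Finset.sum_le_sum fun σ _ => Real.exp_le_exp.2 ?_
      have e : ∑ j, nnS (σ j) * (c * R * ∑ b, w (q (r σ)) b * f (q (r σ)) j b) =
          c * R * ∑ b, w (q (r σ)) b * ∑ j, nnS (σ j) * f (q (r σ)) j b := by
        simp only [Finset.mul_sum]
        rw [Finset.sum_comm]
        refine Finset.sum_congr rfl fun b _ => Finset.sum_congr rfl fun j _ => by ring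
      rw [e]
      refine mul_le_mul_of_nonneg_left ?_ hcR
      refine (le_abs_self _).trans ((nn_cs _ _).trans ?_)
      have := mul_le_mul_of_nonneg_right (hw1 (q (r σ)))
        (nnN_nonneg (fun b => ∑ j, nnS (σ j) * f (q (r σ)) j b))
      simpa using this
  have m1 := main id
  have m2 := main Neg.neg
  rw [← Equiv.sum_comp (Equiv.neg (Fin n → ℤˣ))] at m2
  have : ∑ σ, Real.exp (c * nnN (fun a => ∑ i, nnS (σ i) * φ ((M σ).mulVec (f σ i) a))) ≤
      ∑ σ, Real.exp (c * R * ∑ i, nnS (σ i) * φ (∑ b, w σ b * f σ i b)) +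
      ∑ σ, Real.exp (-(c * R * ∑ i, nnS (σ i) * φ (∑ b, w σ b * f σ i b))) := by
    rw [← Finset.sum_add_distrib]
    refine Finset.sum_le_sum fun σ _ => ?_
    have h := mul_le_mul_of_nonneg_left (hw2 σ) hc
    generalize (∑ i, nnS (σ i) * φ (∑ b, w σ b * f σ i b)) = Z at *
    refine (Real.exp_le_exp.2 h).trans ?_
    rcases abs_cases Z with ⟨h, _⟩ | ⟨h, _⟩ <;> rw [h]
    · rw [← mul_assoc]; linarith [Real.exp_pos (-(c * R * Z))]
    · have : c * (R * -Z) = -(c * R * Z) := by ring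
      rw [this]; linarith [Real.exp_pos (c * R * Z)]
  have e2 : ∑ σ, Real.exp (-(c * R * ∑ i, nnS (σ i) * φ (∑ b, w σ b * f σ i b))) ≤ C := by
    refine le_trans (le_of_eq ?_) m2
    refine Finset.sum_congr rfl fun σ _ => ?_
    simp only [Equiv.neg_apply, neg_neg, Pi.neg_apply, nnS_neg, neg_mul, Finset.sum_neg_distrib,
      mul_neg]
  simp only [id] at m1
  linarith

theorem nn_layers {n : ℕ} (dims : ℕ → ℕ) (φ : ℕ → ℝ → ℝ)
    (hl : ∀ k x y, |φ k x - φ k y| ≤ |x - y|) (h0 : ∀ k, φ k 0 = 0)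
    (hh : ∀ k (c t : ℝ), 0 ≤ c → φ k (c * t) = c * φ k t)
    (B : ℕ → ℝ) (hB : ∀ j, 0 ≤ B j) (x : Fin n → Fin (dims 0) → ℝ) (k : ℕ) :
    ∀ (W : (Fin n → ℤˣ) → ∀ j : ℕ, Matrix (Fin (dims (j + 1))) (Fin (dims j)) ℝ)
    (_ : ∀ σ, ∀ j < k, frobNorm (W σ j) ≤ B j) (c : ℝ) (_ : 0 ≤ c),
    ∑ σ, Real.exp (c * nnN (fun a => ∑ i, nnS (σ i) * layerOut dims (W σ) φ k (x i) a)) ≤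
    2 ^ k * ∑ σ : Fin n → ℤˣ, Real.exp ((c * ∏ j ∈ Finset.range k, B j) *
      nnN (fun a => ∑ i, nnS (σ i) * x i a)) := by
  induction k with
  | zero => intro W _ c _; simp [layerOut]
  | succ k ih =>
    intro W hW c hc
    have := nn_peel (φ k) (hl k) (h0 k) (hh k) (fun σ => W σ k) (B k) (hB k)
      (fun σ => hW σ k (Nat.lt_succ_self k)) (fun σ i => layerOut dims (W σ) φ k (x i)) c _ hc
      (fun r => ih (fun σ => W (r σ)) (fun σ j hj => hW _ j (hj.trans (Nat.lt_succ_self k)))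
        (c * B k) (mul_nonneg hc (hB k)))
    refine this.trans (le_of_eq ?_)
    rw [Finset.prod_range_succ, ← mul_assoc, ← pow_succ']
    congr 1
    refine Finset.sum_congr rfl fun σ _ => ?_
    congr 2
    ring

theorem nn_opt (a c q : ℝ) (hc : 0 < c) (hq : 0 ≤ q)
    (h : ∀ l > 0, l * a ≤ c + l ^ 2 * q ^ 2 / 2) : a ≤ q * Real.sqrt (2 * c) := by
  rcases hq.eq_or_lt with rfl | hq
  · by_contra ha
    push Not at ha
    have ha : 0 < a := by simpa using ha
    have := h (2 * c / a) (by positivity)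
    rw [div_mul_cancel₀ _ ha.ne'] at this
    simp at this
    linarith
  · have hs : 0 < Real.sqrt (2 * c) := Real.sqrt_pos.2 (by linarith)
    have h2 : Real.sqrt (2 * c) ^ 2 = 2 * c := Real.sq_sqrt (by linarith)
    have := h (Real.sqrt (2 * c) / q) (by positivity)
    generalize Real.sqrt (2 * c) = s at *
    have e : (s / q) ^ 2 * q ^ 2 = s ^ 2 := by field_simp
    rw [e] at this
    have e2 : s / q * a * q = s * a := by field_simp
    have := mul_le_mul_of_nonneg_right this hq.le
    rw [e2] at this
    have : s * a ≤ s * (q * s) := by nlinarith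
    exact le_of_mul_le_mul_left this hs

theorem nn_rad_singleton (s : ℤˣ) : radMeasure {nnS s} = 1 / 2 := by
  rcases Int.units_eq_one_or s with h | h <;> subst h <;>
    norm_num [radMeasure, nnS, Set.indicator]

instance nn_rad_prob : IsProbabilityMeasure radMeasure := ⟨by
  simp [radMeasure, ENNReal.inv_two_add_inv_two]⟩

theorem nnS_inj : Function.Injective nnS := by
  intro a b h
  simp only [nnS, Int.cast_inj] at h
  exact Units.ext h

theorem nn_integral {n : ℕ} (g : (Fin n → ℝ) → ℝ) :
    ∫ σ, g σ ∂(Measure.pi fun _ : Fin n => radMeasure) =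
      (∑ σ : Fin n → ℤˣ, g (fun i => nnS (σ i))) / (Fintype.card (Fin n → ℤˣ) : ℝ) := by
  classical
  set μ := (Measure.pi fun _ : Fin n => radMeasure) with hμ
  let e : (Fin n → ℤˣ) ↪ (Fin n → ℝ) := ⟨fun σ i => nnS (σ i), fun a b h => by
    funext i; exact nnS_inj (congrFun h i)⟩
  set S := Finset.univ.map e with hS
  have h1 : ∀ᵐ y ∂radMeasure, y = 1 ∨ y = -1 := by
    rw [radMeasure, ae_add_measure_iff]
    constructor <;> apply Measure.ae_smul_measure <;> rw [ae_dirac_eq] <;> simp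
  have h2 : ∀ᵐ y ∂μ, y ∈ (S : Set (Fin n → ℝ)) := by
    have : ∀ᵐ y ∂μ, ∀ i, y i = 1 ∨ y i = -1 := by
      rw [ae_all_iff]
      intro i
      exact (Measure.tendsto_eval_ae_ae (μ := fun _ : Fin n => radMeasure) (i := i)).eventually h1
    filter_upwards [this] with y hy
    have : ∀ i, ∃ s : ℤˣ, nnS s = y i := by
      intro i
      rcases hy i with h | h
      · exact ⟨1, by simp [nnS, h]⟩
      · exact ⟨-1, by simp [nnS, h]⟩
    choose s hs using this
    simp only [hS, Finset.coe_map, Set.mem_image, Finset.coe_univ, Set.mem_univ, true_and]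
    exact ⟨s, funext hs⟩
  rw [← Measure.restrict_eq_self_of_ae_mem h2, setIntegral_finset]
  · rw [hS, Finset.sum_map, Finset.sum_div]
    refine Finset.sum_congr rfl fun σ _ => ?_
    have : μ {e σ} = (1 / 2) ^ n := by
      rw [hμ, Measure.pi_singleton]
      have : ∀ i, radMeasure {e σ i} = 1 / 2 := fun i => nn_rad_singleton (σ i)
      simp [this]
    rw [Measure.real, this]
    have hc : (Fintype.card (Fin n → ℤˣ) : ℝ) = 2 ^ n := by simp
    rw [hc]
    have he : e σ = fun i => nnS (σ i) := rfl
    rw [he]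
    simp [div_eq_inv_mul]
  · exact IntegrableOn.of_finite S.finite_toSet

/-- for a fixed sample -/
theorem nn_fixed (k : ℕ) (dims : ℕ → ℕ) (hout : dims (k + 1) = 1)
    (φ : ℕ → ℝ → ℝ) (hl : ∀ k x y, |φ k x - φ k y| ≤ |x - y|) (h0 : ∀ k, φ k 0 = 0)
    (hh : ∀ k (c t : ℝ), 0 ≤ c → φ k (c * t) = c * φ k t)
    (B : ℕ → ℝ) (hB : ∀ j, 0 ≤ B j) (b : ℝ) (hb : 0 ≤ b) (n : ℕ) (hn : 0 < n)
    (x : Fin n → Fin (dims 0) → ℝ) (hx : ∀ i, nnN (x i) ≤ b)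
    (W : (Fin n → ℤˣ) → ∀ j : ℕ, Matrix (Fin (dims (j + 1))) (Fin (dims j)) ℝ)
    (hW : ∀ σ, ∀ j < k + 1, frobNorm (W σ j) ≤ B j) :
    (∑ σ, |(1 / (n : ℝ)) * ∑ i, nnS (σ i) *
      ∑ a, (W σ k).mulVec (layerOut dims (W σ) φ k (x i)) a|) / (Fintype.card (Fin n → ℤˣ) : ℝ) ≤
    b * Real.sqrt (2 * Real.log 2 * (k + 1)) * (∏ j ∈ Finset.range (k + 1), B j) / Real.sqrt n := by
  set N : ℝ := (Fintype.card (Fin n → ℤˣ) : ℝ) with hN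
  have hN0 : 0 < N := by rw [hN]; exact_mod_cast Fintype.card_pos
  set P := ∏ j ∈ Finset.range (k + 1), B j with hP
  have hP0 : 0 ≤ P := Finset.prod_nonneg fun j _ => hB j
  have hn' : (0 : ℝ) < n := by exact_mod_cast hn
  set F : (Fin n → ℤˣ) → ℝ := fun σ => |(1 / (n : ℝ)) * ∑ i, nnS (σ i) *
      ∑ a, (W σ k).mulVec (layerOut dims (W σ) φ k (x i)) a| with hF
  have hFb : ∀ σ, n * F σ ≤ B k *
      nnN (fun a => ∑ i, nnS (σ i) * layerOut dims (W σ) φ k (x i) a) := by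
    intro σ
    set y := fun i => layerOut dims (W σ) φ k (x i)
    set Y := (fun a => ∑ i, nnS (σ i) * y i a) with hY
    have e1 : (n : ℝ) * F σ = |∑ i, nnS (σ i) * ∑ a, (W σ k).mulVec (y i) a| := by
      simp only [hF, abs_mul, abs_of_pos (one_div_pos.2 hn')]
      rw [← mul_assoc, mul_one_div_cancel hn'.ne', one_mul]
    have e2 : ∑ i, nnS (σ i) * ∑ a, (W σ k).mulVec (y i) a = ∑ a, ∑ c, W σ k a c * Y c := by
      simp only [hY, Matrix.mulVec, dotProduct, Finset.mul_sum]
      rw [Finset.sum_comm]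
      refine Finset.sum_congr rfl fun a _ => ?_
      rw [Finset.sum_comm]
      refine Finset.sum_congr rfl fun c _ => Finset.sum_congr rfl fun i _ => by ring
    rw [e1, e2]
    refine le_trans ?_ (mul_le_mul_of_nonneg_right (hW σ k (Nat.lt_succ_self k)) (nnN_nonneg Y))
    have hf0 : 0 ≤ frobNorm (W σ k) := Real.sqrt_nonneg _
    refine abs_le_of_sq_le_sq ?_ (mul_nonneg hf0 (nnN_nonneg _))
    refine sq_sum_le_card_mul_sum_sq.trans ?_
    rw [mul_pow, nn_frob_sq]
    simp only [Finset.card_univ, Fintype.card_fin, hout, Nat.cast_one, one_mul, Finset.sum_mul]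
    refine Finset.sum_le_sum fun a _ => ?_
    rw [← Finset.sum_mul, nnN_sq]
    exact Finset.sum_mul_sq_le_sq_mul_sq _ _ _
  have key : ∀ l > 0, l * (n * ((∑ σ, F σ) / N)) ≤
      (k + 1) * Real.log 2 + l ^ 2 * (P * Real.sqrt n * b) ^ 2 / 2 := by
    intro l hl0
    have j1 : Real.exp (∑ σ, (1 / N) • (l * (n * F σ))) ≤ ∑ σ, (1 / N) • Real.exp (l * (n * F σ)) :=
      convexOn_exp.map_sum_le (fun _ _ => (one_div_pos.2 hN0).le)
        (by
          rw [Finset.sum_const, Finset.card_univ, nsmul_eq_mul, ← hN]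
          exact mul_one_div_cancel hN0.ne') (fun _ _ => Set.mem_univ _)
    have j2 : ∑ σ, (1 / N) • (l * (n * F σ)) = l * (n * ((∑ σ, F σ) / N)) := by
      simp only [smul_eq_mul, Finset.sum_div, Finset.mul_sum]
      refine Finset.sum_congr rfl fun σ _ => by ring
    rw [j2] at j1
    have j3 : ∑ σ, Real.exp (l * (n * F σ)) ≤ ∑ σ, Real.exp ((l * B k) *
        nnN (fun a => ∑ i, nnS (σ i) * layerOut dims (W σ) φ k (x i) a)) := by
      refine Finset.sum_le_sum fun σ _ => Real.exp_le_exp.2 ?_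
      rw [mul_assoc]
      exact mul_le_mul_of_nonneg_left (hFb σ) hl0.le
    have j4 := nn_layers dims φ hl h0 hh B hB x k W
      (fun σ j hj => hW σ j (hj.trans (Nat.lt_succ_self k))) (l * B k) (mul_nonneg hl0.le (hB k))
    have j5 := nn_exp_sum x (l * B k * ∏ j ∈ Finset.range k, B j) b hx
    have j6 : Real.exp (l * (n * ((∑ σ, F σ) / N))) ≤
        Real.exp ((k + 1) * Real.log 2 + l ^ 2 * (P * Real.sqrt n * b) ^ 2 / 2) := by
      have e1 : l * B k * ∏ j ∈ Finset.range k, B j = l * P := by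
        rw [hP, Finset.prod_range_succ]; ring
      rw [e1] at j4 j5
      have e2 : (l * P) ^ 2 * (n * b ^ 2) / 2 = l ^ 2 * (P * Real.sqrt n * b) ^ 2 / 2 := by
        rw [mul_pow (P * Real.sqrt n), mul_pow P, Real.sq_sqrt hn'.le]; ring
      rw [e2] at j5
      have e3 : Real.exp ((k + 1) * Real.log 2) = 2 ^ (k + 1) := by
        have := Real.exp_nat_mul (Real.log 2) (k + 1)
        rw [Real.exp_log two_pos] at this
        exact_mod_cast this
      rw [Real.exp_add, e3]
      simp only [smul_eq_mul, ← Finset.mul_sum] at j1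
      refine j1.trans ?_
      rw [one_div, inv_mul_le_iff₀ hN0]
      refine j3.trans (j4.trans ((mul_le_mul_of_nonneg_left j5 (by positivity)).trans (le_of_eq ?_)))
      rw [← hN]; ring
    exact Real.exp_le_exp.1 j6
  have := nn_opt _ _ _ (by have := Real.log_pos one_lt_two; positivity) (by positivity) key
  rw [le_div_iff₀ (Real.sqrt_pos.2 hn')]
  have hs : Real.sqrt n * Real.sqrt n = n := Real.mul_self_sqrt hn'.le
  have hs0 : 0 < Real.sqrt n := Real.sqrt_pos.2 hn'
  have e : 2 * ((k + 1) * Real.log 2) = 2 * Real.log 2 * (k + 1) := by ring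
  rw [e] at this
  generalize Real.sqrt (2 * Real.log 2 * (k + 1)) = T at *
  refine le_of_mul_le_mul_left ?_ hs0
  calc _ = (Real.sqrt n * Real.sqrt n) * ((∑ σ, F σ) / N) := by ring
    _ = n * ((∑ σ, F σ) / N) := by rw [hs]
    _ ≤ _ := this
    _ = _ := by ring

/-- Rademacher complexity bound for norm-bounded positive-homogeneous neural networks
(Golowich et al.): the class `H` of depth-`L` real-valued networks
`x ↦ W_L φ_{L-1}(W_{L-1} ⋯ φ₁(W₁ x))` with `‖W_j‖_F ≤ B j`, `1`-Lipschitz positive-homogeneous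
element-wise activations, over a distribution with support bounded by `Bp`, has two-sided
Rademacher complexity at most `Bp (√(2 log 2 · L) + 1) ∏_j B j / √n`. -/
theorem statement_15 (L : ℕ) (hL : 0 < L) (dims : ℕ → ℕ) (hout : dims L = 1)
    (φ : ℕ → ℝ → ℝ) (hφ_lip : ∀ j, LipschitzWith 1 (φ j))
    (hφ_hom : ∀ j (c t : ℝ), 0 ≤ c → φ j (c * t) = c * φ j t)
    (B : ℕ → ℝ) (hB : ∀ j, 0 ≤ B j)
    (p : Measure (Fin (dims 0) → ℝ)) [IsProbabilityMeasure p]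
    (Bp : ℝ) (hBp : ∀ᵐ x ∂p, Real.sqrt (∑ i, x i ^ 2) ≤ Bp)
    (H : Set ((Fin (dims 0) → ℝ) → ℝ))
    (hH : H = {h | ∃ W : ∀ j : ℕ, Matrix (Fin (dims (j + 1))) (Fin (dims j)) ℝ,
      (∀ j < L, frobNorm (W j) ≤ B j) ∧
      ∀ x, h x = ∑ i, (W (L - 1)).mulVec (layerOut dims W φ (L - 1) x) i})
    (n : ℕ) (hn : 0 < n) :
    (∫ X : Fin n → (Fin (dims 0) → ℝ),
        (∫ σ : Fin n → ℝ,
          (⨆ h ∈ H, |(1 / (n : ℝ)) * ∑ i, σ i * h (X i)|)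
          ∂(Measure.pi fun _ => radMeasure))
        ∂(Measure.pi fun _ => p)) ≤
      Bp * (Real.sqrt (2 * Real.log 2 * L) + 1) * (∏ j ∈ Finset.range L, B j) /
        Real.sqrt n := by
  obtain ⟨k, rfl⟩ : ∃ k, L = k + 1 := ⟨L - 1, by omega⟩
  replace hH : H = {h | ∃ W : ∀ j : ℕ, Matrix (Fin (dims (j + 1))) (Fin (dims j)) ℝ,
      (∀ j < k + 1, frobNorm (W j) ≤ B j) ∧
      ∀ x, h x = ∑ i, (W k).mulVec (layerOut dims W φ k x) i} := hH
  have hl : ∀ k x y, |φ k x - φ k y| ≤ |x - y| := by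
    intro k x y
    have := (hφ_lip k).dist_le_mul x y
    simpa [Real.dist_eq] using this
  have h0 : ∀ k, φ k 0 = 0 := fun k => by simpa using hφ_hom k 0 0 le_rfl
  have hb : 0 ≤ Bp := by
    obtain ⟨x, hx⟩ := hBp.exists
    exact (Real.sqrt_nonneg _).trans hx
  have hP0 : 0 ≤ ∏ j ∈ Finset.range (k + 1), B j := Finset.prod_nonneg fun j _ => hB j
  have hne : H.Nonempty := by
    refine ⟨fun x => ∑ i, ((fun j => 0 : ∀ j : ℕ, Matrix (Fin (dims (j + 1))) (Fin (dims j)) ℝ)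
      k).mulVec (layerOut dims (fun _ => 0) φ k x) i, ?_⟩
    rw [hH]
    exact ⟨fun _ => 0, fun j _ => by simpa [frobNorm] using hB j, fun x => rfl⟩
  have hsup : ∀ (X : Fin n → (Fin (dims 0) → ℝ)) (s : Fin n → ℝ) (ε : ℝ), 0 < ε → ∃ h ∈ H,
      (⨆ h ∈ H, |(1 / (n : ℝ)) * ∑ i, s i * h (X i)|) ≤
        |(1 / (n : ℝ)) * ∑ i, s i * h (X i)| + ε := by
    intro X s ε hε
    by_contra hcon
    push Not at hcon
    set S := (⨆ h ∈ H, |(1 / (n : ℝ)) * ∑ i, s i * h (X i)|)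
    obtain ⟨h, hh⟩ := hne
    have hS : 0 ≤ S - ε := by
      linarith [hcon h hh, abs_nonneg ((1 / (n : ℝ)) * ∑ i, s i * h (X i))]
    have : S ≤ S - ε := Real.iSup_le (fun h => Real.iSup_le (fun hh => by linarith [hcon h hh]) hS) hS
    linarith
  set T := Bp * (Real.sqrt (2 * Real.log 2 * (k + 1 : ℕ)) + 1) *
    (∏ j ∈ Finset.range (k + 1), B j) / Real.sqrt n with hT
  have hpt : ∀ X : Fin n → (Fin (dims 0) → ℝ), (∀ i, nnN (X i) ≤ Bp) →
      (∫ σ : Fin n → ℝ, (⨆ h ∈ H, |(1 / (n : ℝ)) * ∑ i, σ i * h (X i)|)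
          ∂(Measure.pi fun _ => radMeasure)) ≤ T := by
    intro X hX
    rw [nn_integral]
    apply le_of_forall_pos_le_add
    intro ε hε
    choose h hh1 hh2 using fun σ : Fin n → ℤˣ => hsup X (fun i => nnS (σ i)) ε hε
    have hh3 : ∀ σ, ∃ W : ∀ j : ℕ, Matrix (Fin (dims (j + 1))) (Fin (dims j)) ℝ,
      (∀ j < k + 1, frobNorm (W j) ≤ B j) ∧
      ∀ x, h σ x = ∑ i, (W k).mulVec (layerOut dims W φ k x) i := by
      intro σ
      have := hh1 σ
      rw [hH] at this
      exact this
    choose W hW1 hW2 using hh3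
    have main := nn_fixed k dims hout φ hl h0 hφ_hom B hB Bp hb n hn X hX W hW1
    have hN0 : (0 : ℝ) < (Fintype.card (Fin n → ℤˣ) : ℝ) := by exact_mod_cast Fintype.card_pos
    have hT' : Bp * Real.sqrt (2 * Real.log 2 * (k + 1)) * (∏ j ∈ Finset.range (k + 1), B j) /
        Real.sqrt n ≤ T := by
      rw [hT]
      push_cast
      gcongr
      linarith
    refine le_trans ?_ (add_le_add_left (main.trans hT') ε)
    rw [div_add' _ _ _ hN0.ne']
    refine div_le_div_of_nonneg_right ?_ hN0.le
    refine (Finset.sum_le_sum fun σ _ => hh2 σ).trans (le_of_eq ?_)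
    rw [Finset.sum_add_distrib]
    simp only [hW2, Finset.sum_const, Finset.card_univ, nsmul_eq_mul]
    ring
  have hae : ∀ᵐ X ∂(Measure.pi fun _ : Fin n => p), ∀ i, nnN (X i) ≤ Bp := by
    rw [ae_all_iff]
    intro i
    exact (Measure.tendsto_eval_ae_ae (μ := fun _ : Fin n => p) (i := i)).eventually hBp
  calc _ ≤ ∫ X : Fin n → (Fin (dims 0) → ℝ), T ∂(Measure.pi fun _ => p) := by
        apply integral_mono_of_nonneg
        · refine Filter.Eventually.of_forall fun X => integral_nonneg fun σ => ?_
          exact Real.iSup_nonneg fun h => Real.iSup_nonneg fun _ => abs_nonneg _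
        · exact integrable_const _
        · filter_upwards [hae] with X hX using hpt X hX
    _ = T := by simp
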